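/- Let L be a bounded distributive totally ordered lattice (a bounded chain), n ≥ 1, let p : L^n → L be a weighted lattice polynomial function, and let β : 2^[n] → L be any set function. Then p^∧_β = p if and only if β_p ≤ β ≤ β*_p pointwise, where β_p(S) := p(e_{[n]∖S}) and β*_p(S) := β_p(S) if β_p(S) < β_p(S∖{i}) for every i ∈ S, and β*_p(S) := 1 otherwise. -/

import Mathlib

/-- Weighted lattice polynomial (w.l.p.) functions from `L^n` to `L`: the smallest
class containing all coordinate projections and all constant functions, and closed
under pointwise `⊓` and `⊔`. -/
inductive IsWLP {L : Type*} [Lattice L] {n : ℕ} : ((Fin n → L) → L) → Prop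
  | proj (k : Fin n) : IsWLP (fun x => x k)
  | const (c : L) : IsWLP (fun _ => c)
  | inf {p q : (Fin n → L) → L} : IsWLP p → IsWLP q → IsWLP (fun x => p x ⊓ q x)
  | sup {p q : (Fin n → L) → L} : IsWLP p → IsWLP q → IsWLP (fun x => p x ⊔ q x)

/-- The characteristic vector `e_S` of `S ⊆ [n]`: its `i`-th component is `1` (top)
if `i ∈ S` and `0` (bottom) otherwise. -/
def charVec (L : Type*) [Lattice L] [BoundedOrder L] {n : ℕ} (S : Finset (Fin n)) :
    Fin n → L :=
  fun i => if i ∈ S then ⊤ else ⊥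

namespace IsWLP

theorem le_sup_of_forall_le_sup {L : Type*} [DistribLattice L] {n : ℕ}
    {p : (Fin n → L) → L} (hp : IsWLP p) {x y : Fin n → L} {c : L}
    (h : ∀ i, x i ≤ y i ⊔ c) : p x ≤ p y ⊔ c := by
  induction hp with
  | proj k => exact h k
  | const d => exact le_sup_left
  | inf _ _ hp hq =>
    rw [sup_inf_right]
    exact inf_le_inf hp hq
  | sup _ _ hp hq =>
    rw [sup_sup_distrib_right]
    exact sup_le_sup hp hq

theorem inf_le_of_forall_inf_le {L : Type*} [DistribLattice L] {n : ℕ}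
    {p : (Fin n → L) → L} (hp : IsWLP p) {x y : Fin n → L} {c : L}
    (h : ∀ i, y i ⊓ c ≤ x i) : p y ⊓ c ≤ p x := by
  induction hp with
  | proj k => exact h k
  | const d => exact inf_le_left
  | inf _ _ hp hq =>
    rw [inf_inf_distrib_right]
    exact inf_le_inf hp hq
  | sup _ _ hp hq =>
    rw [inf_sup_right]
    exact sup_le_sup hp hq

theorem monotone {L : Type*} [Lattice L] {n : ℕ}
    {p : (Fin n → L) → L} (hp : IsWLP p) : Monotone p := by
  intro x y h
  induction hp with
  | proj k => exact h k
  | const d => exact le_rfl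
  | inf _ _ hp hq => exact inf_le_inf hp hq
  | sup _ _ hp hq => exact sup_le_sup hp hq

end IsWLP

theorem charVec_mono {L : Type*} [Lattice L] [BoundedOrder L] {n : ℕ} :
    Monotone (charVec L : Finset (Fin n) → Fin n → L) := by
  intro S T h i
  by_cases hS : i ∈ S
  · simp [charVec, hS, h hS]
  · simp [charVec, hS]

namespace IsWLP

theorem le_charVec_sup {L : Type*} [DistribLattice L] [BoundedOrder L] {n : ℕ}
    {p : (Fin n → L) → L} (hp : IsWLP p) (S : Finset (Fin n)) (x : Fin n → L) :
    p x ≤ p (charVec L (Finset.univ \ S)) ⊔ S.sup x := by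
  refine hp.le_sup_of_forall_le_sup fun i => ?_
  by_cases hS : i ∈ S
  · exact le_sup_of_le_right (Finset.le_sup hS)
  · simp [charVec, hS]

theorem exists_charVec_sup_le {L : Type*} [LinearOrder L] [BoundedOrder L] {n : ℕ}
    {p : (Fin n → L) → L} (hp : IsWLP p) (x : Fin n → L) :
    ∃ S : Finset (Fin n), p (charVec L (Finset.univ \ S)) ⊔ S.sup x ≤ p x := by
  set S : Finset (Fin n) := {i | x i ≤ p x} with hS
  refine ⟨S, sup_le ?_ (Finset.sup_le fun i hi => by simpa [hS] using hi)⟩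
  have key : p (charVec L (Finset.univ \ S)) ⊓ (Finset.univ \ S).inf x ≤ p x := by
    refine hp.inf_le_of_forall_inf_le fun i => ?_
    by_cases hi : i ∈ S
    · simp [charVec, hi]
    · exact inf_le_of_right_le (Finset.inf_le (by simpa using hi))
  rcases inf_le_iff.mp key with h | h
  · exact h
  · rcases eq_or_ne (p x) ⊤ with htop | htop
    · exact htop ▸ le_top
    · refine absurd h (not_le.mpr ((Finset.lt_inf_iff (lt_top_iff_ne_top.mpr htop)).mpr ?_))
      intro i hi
      simpa [hS] using hi

theorem antitone_charVec_sdiff {L : Type*} [Lattice L] [BoundedOrder L] {n : ℕ}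
    {p : (Fin n → L) → L} (hp : IsWLP p) :
    Antitone fun S : Finset (Fin n) => p (charVec L (Finset.univ \ S)) :=
  fun _ _ h => hp.monotone (charVec_mono (Finset.sdiff_subset_sdiff subset_rfl h))

end IsWLP

/-- On a bounded chain, `p^∧_β = p` iff `β_p ≤ β ≤ β*_p`, where `β_p S = p (e_{[n]\S})`
and `β*_p S = β_p S` if `β_p S < β_p (S \ {i})` for all `i ∈ S`, else `β*_p S = 1`. -/
theorem wlp_conjunctive_defining_set_functions
    {L : Type*} [LinearOrder L] [BoundedOrder L] {n : ℕ} (hn : 1 ≤ n)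
    (p : (Fin n → L) → L) (hp : IsWLP p) (β : Finset (Fin n) → L) :
    (∀ x : Fin n → L,
        Finset.univ.inf (fun S : Finset (Fin n) => β S ⊔ S.sup x) = p x) ↔
      (∀ S : Finset (Fin n),
        p (charVec L (Finset.univ \ S)) ≤ β S ∧
        β S ≤ (if ∀ i ∈ S, p (charVec L (Finset.univ \ S)) <
                  p (charVec L (Finset.univ \ S.erase i))
          then p (charVec L (Finset.univ \ S)) else (⊤ : L))) := by
  constructor
  · intro h
    have lower (S : Finset (Fin n)) : p (charVec L (Finset.univ \ S)) ≤ β S := by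
      rw [← h]
      refine (Finset.inf_le (Finset.mem_univ S)).trans (sup_le le_rfl ?_)
      refine Finset.sup_le fun i hi => ?_
      simp [charVec, hi]
    refine fun S => ⟨lower S, ?_⟩
    split_ifs with hlt
    · by_contra! hβ
      have hx := (h (charVec L (Finset.univ \ S))).le
      obtain ⟨T, -, hT⟩ := (Finset.inf_le_iff (hβ.trans_le le_top)).mp hx
      obtain ⟨hT₁, hT₂⟩ := sup_le_iff.mp hT
      have hTS : T ⊆ S := by
        intro i hi
        by_contra hiS
        have htop := (Finset.le_sup (f := charVec L (Finset.univ \ S)) hi).trans hT₂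
        simp only [charVec, Finset.mem_sdiff, Finset.mem_univ, hiS, not_false_eq_true,
          and_self, if_true] at htop
        exact absurd (hβ.trans_le le_top) (not_lt.mpr htop)
      rcases eq_or_ne T S with rfl | hne
      · exact absurd hT₁ hβ.not_ge
      · obtain ⟨i, hi, hiT⟩ := Finset.exists_of_ssubset (hTS.ssubset_of_ne hne)
        have hsub : T ⊆ S.erase i := Finset.subset_erase.mpr ⟨hTS, hiT⟩
        exact absurd (((hp.antitone_charVec_sdiff hsub).trans (lower T)).trans hT₁)
          (hlt i hi).not_ge
    · exact le_top
  · intro h x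
    apply le_antisymm
    · obtain ⟨S, hS⟩ := exists_minimal_of_wellFoundedLT _ (hp.exists_charVec_sup_le x)
      have hlt : ∀ i ∈ S, p (charVec L (Finset.univ \ S)) <
          p (charVec L (Finset.univ \ S.erase i)) := by
        intro i hi
        by_contra! hle
        have hmem := (sup_le_sup hle (Finset.sup_mono (f := x) (S.erase_subset i))).trans hS.prop
        exact Finset.notMem_erase i S (hS.le_of_le hmem (S.erase_subset i) hi)
      have hβ := (h S).2
      rw [if_pos hlt] at hβ
      exact (Finset.inf_le (Finset.mem_univ S)).trans ((sup_le_sup_right hβ _).trans hS.prop)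
    · exact Finset.le_inf fun S _ =>
        (hp.le_charVec_sup S x).trans (sup_le_sup_right (h S).1 _)
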